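/- Let Γ be an infinite finitely generated group and let μ be a symmetric admissible probability measure on Γ. Then the function r ↦ ω_Γ(r) is continuous on the open interval (0, R). More precisely, for every δ > 0 there is a constant c = c(δ) such that for all δ ≤ s < r ≤ R − δ one has 0 ≤ ω_Γ(r) − ω_Γ(s) ≤ c (log r − log s). -/

import Mathlib

open scoped Pointwise Classical
open Filter

namespace GreenGrowth

variable {G : Type*} [Group G]

/-- Word length with respect to a finite generating set `S` (symmetrized). -/
noncomputable def wordLength (S : Finset G) (x : G) : ℕ :=
  sInf {n : ℕ | x ∈ ((S : Set G) ∪ (S : Set G)⁻¹) ^ n}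

/-- `n`-step distribution of the `μ`-random walk: the `n`-fold convolution power of `μ`,
so that `p_n(x, y) = convPow μ n (x⁻¹ * y)`. -/
noncomputable def convPow (μ : G → ℝ) : ℕ → G → ℝ
  | 0 => fun x => if x = 1 then 1 else 0
  | n + 1 => fun x => ∑' y : G, μ y * convPow μ n (y⁻¹ * x)

/-- The Green function `G(e, x | r)`. -/
noncomputable def green (μ : G → ℝ) (r : ℝ) (x : G) : ℝ :=
  ∑' n : ℕ, r ^ n * convPow μ n x

/-- `μ` is a probability measure on `G`. -/
def IsProbMeasure (μ : G → ℝ) : Prop := (∀ x, 0 ≤ μ x) ∧ HasSum μ 1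

/-- `μ` is admissible: its support generates `G` as a semigroup, i.e. every element of `G`
is reached with positive probability at some time. -/
def IsAdmissible (μ : G → ℝ) : Prop := ∀ x : G, ∃ n : ℕ, 0 < convPow μ n x

/-- `μ` is symmetric. -/
def IsSymm (μ : G → ℝ) : Prop := ∀ x : G, μ x⁻¹ = μ x

/-- The spectral radius of the `μ`-random walk. -/
noncomputable def spectralRadius (μ : G → ℝ) : ℝ :=
  limsup (fun n : ℕ => (convPow μ n 1) ^ ((n : ℝ)⁻¹)) atTop

/-- `R`, the radius of convergence of the Green function: the inverse of the
spectral radius. -/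
noncomputable def greenRadius (μ : G → ℝ) : ℝ := (spectralRadius μ)⁻¹

/-- The `μ`-random walk is transient at the spectral radius: the Green function
`G(x, y | r)` is finite for all `x, y` and all `0 < r ≤ R`. -/
def TransientAtSpectralRadius (μ : G → ℝ) : Prop :=
  ∀ r : ℝ, 0 < r → r ≤ greenRadius μ →
    ∀ x : G, Summable (fun n : ℕ => r ^ n * convPow μ n x)

/-- `H_r(n) = Σ_{x ∈ S_n} G(e, x | r)`, the sum of the Green function over the sphere
of radius `n`. -/
noncomputable def greenSphereSum (S : Finset G) (μ : G → ℝ) (r : ℝ) (n : ℕ) : ℝ :=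
  ∑' x : G, if wordLength S x = n then green μ r x else 0

/-- `ω_Γ(r) = limsup (1/n) log H_r(n)`, the growth rate of the Green function. -/
noncomputable def greenGrowthRate (S : Finset G) (μ : G → ℝ) (r : ℝ) : ℝ :=
  limsup (fun n : ℕ => Real.log (greenSphereSum S μ r n) / n) atTop

/-- The cardinality of the sphere of radius `n`. -/
noncomputable def sphereCard (S : Finset G) (n : ℕ) : ℕ :=
  Nat.card {x : G // wordLength S x = n}

/-- The volume growth rate `v = limsup (1/n) log #S_n`. -/
noncomputable def volumeGrowthRate (S : Finset G) : ℝ :=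
  limsup (fun n : ℕ => Real.log (sphereCard S n) / n) atTop

end GreenGrowth

namespace GreenGrowth

open scoped ENNReal Topology

/-- The convolution powers of a measure with values in `ℝ≥0∞`. -/
noncomputable def econvPow {G : Type*} [Group G] (ν : G → ℝ≥0∞) : ℕ → G → ℝ≥0∞
  | 0 => fun x => if x = 1 then 1 else 0
  | n + 1 => fun x => ∑' y : G, ν y * econvPow ν n (y⁻¹ * x)

section ENNReal

variable {G : Type*} [Group G] {ν : G → ℝ≥0∞}

lemma econvPow_add (m n : ℕ) (x : G) :
    econvPow ν (m + n) x = ∑' y : G, econvPow ν m y * econvPow ν n (y⁻¹ * x) := by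
  induction m generalizing x with
  | zero =>
    rw [tsum_eq_single 1]
    · simp [econvPow]
    · intro y hy
      simp [econvPow, hy]
  | succ m ih =>
    have h1 : m + 1 + n = (m + n) + 1 := by omega
    rw [h1]
    simp only [econvPow, ih]
    have h2 : ∀ y : G, ν y * ∑' z : G, econvPow ν m z * econvPow ν n (z⁻¹ * (y⁻¹ * x)) =
        ∑' w : G, ν y * econvPow ν m (y⁻¹ * w) * econvPow ν n (w⁻¹ * x) := by
      intro y
      rw [← ENNReal.tsum_mul_left, ← (Equiv.mulLeft y⁻¹).tsum_eq]
      refine tsum_congr fun w => ?_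
      simp [mul_assoc]
    simp only [h2]
    rw [ENNReal.tsum_comm]
    exact tsum_congr fun w => ENNReal.tsum_mul_right

lemma econvPow_one : econvPow ν 1 = ν := by
  funext x
  simp only [econvPow]
  rw [tsum_eq_single x]
  · simp
  · intro y hy
    have : y⁻¹ * x ≠ 1 := fun h => hy (inv_mul_eq_one.mp h)
    simp [this]

lemma tsum_econvPow (hν : ∑' x, ν x = 1) (n : ℕ) : ∑' x, econvPow ν n x = 1 := by
  induction n with
  | zero => simp [econvPow]
  | succ n ih =>
    simp only [econvPow]
    rw [ENNReal.tsum_comm]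
    have h : ∀ y : G, ∑' x : G, ν y * econvPow ν n (y⁻¹ * x) = ν y := by
      intro y
      have h' := (Equiv.mulLeft y⁻¹).tsum_eq (econvPow ν n)
      simp only [Equiv.coe_mulLeft] at h'
      rw [ENNReal.tsum_mul_left, h', ih, mul_one]
    simp only [h, hν]

lemma econvPow_inv (hν : ∀ x, ν x⁻¹ = ν x) (n : ℕ) (x : G) :
    econvPow ν n x⁻¹ = econvPow ν n x := by
  induction n generalizing x with
  | zero => simp [econvPow]
  | succ n ih =>
    rw [econvPow_add n 1 x, econvPow_one]
    simp only [econvPow]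
    rw [← (Equiv.mulLeft x⁻¹).tsum_eq]
    refine tsum_congr fun z => ?_
    have h1 : ν (x⁻¹ * z) = ν (z⁻¹ * x) := by rw [← hν]; simp
    have h2 : econvPow ν n ((x⁻¹ * z)⁻¹ * x⁻¹) = econvPow ν n z := by rw [← ih z]; simp
    simp only [Equiv.coe_mulLeft, h1, h2, mul_comm]

lemma _root_.ENNReal.two_mul_le_add_sq (a b : ℝ≥0∞) : 2 * a * b ≤ a ^ 2 + b ^ 2 := by
  wlog h : a ≤ b generalizing a b
  · rw [add_comm, mul_assoc, mul_comm a, ← mul_assoc]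
    exact this b a (le_of_not_ge h)
  obtain ⟨d, rfl⟩ := exists_add_of_le h
  calc 2 * a * (a + d) ≤ 2 * a * (a + d) + d ^ 2 := le_self_add
    _ = a ^ 2 + (a + d) ^ 2 := by ring

lemma econvPow_two_mul_le (hν : ∀ x, ν x⁻¹ = ν x) (n : ℕ) (x : G) :
    econvPow ν (n + n) x ≤ econvPow ν (n + n) 1 := by
  have h1 : econvPow ν (n + n) 1 = ∑' y : G, econvPow ν n y ^ 2 := by
    rw [econvPow_add]
    refine tsum_congr fun y => ?_
    rw [mul_one, econvPow_inv hν, sq]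
  have h2 : ∑' y : G, econvPow ν n (y⁻¹ * x) ^ 2 = ∑' y : G, econvPow ν n y ^ 2 := by
    rw [← ((Equiv.inv G).trans (Equiv.mulRight x)).tsum_eq (fun y => econvPow ν n y ^ 2)]
    simp
  have h3 : 2 * econvPow ν (n + n) x ≤ 2 * econvPow ν (n + n) 1 := by
    calc 2 * econvPow ν (n + n) x
        = ∑' y : G, 2 * econvPow ν n y * econvPow ν n (y⁻¹ * x) := by
          rw [econvPow_add, ← ENNReal.tsum_mul_left]
          simp only [mul_assoc]
      _ ≤ ∑' y : G, (econvPow ν n y ^ 2 + econvPow ν n (y⁻¹ * x) ^ 2) :=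
          ENNReal.tsum_le_tsum fun y => ENNReal.two_mul_le_add_sq _ _
      _ = 2 * econvPow ν (n + n) 1 := by
          rw [ENNReal.tsum_add, h2, ← h1, two_mul]
  exact (ENNReal.mul_le_mul_iff_right two_ne_zero ENNReal.ofNat_ne_top).mp h3

lemma econvPow_succ_le (hν1 : ∑' x, ν x = 1) (n : ℕ) (a : ℝ≥0∞)
    (h : ∀ x, econvPow ν n x ≤ a) (x : G) : econvPow ν (n + 1) x ≤ a := by
  simp only [econvPow]
  calc ∑' y : G, ν y * econvPow ν n (y⁻¹ * x) ≤ ∑' y : G, ν y * a :=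
        ENNReal.tsum_le_tsum fun y => mul_le_mul_right (h _) _
    _ = a := by rw [ENNReal.tsum_mul_right, hν1, one_mul]

lemma econvPow_le_one (hν : ∑' x, ν x = 1) (n : ℕ) (x : G) : econvPow ν n x ≤ 1 :=
  (ENNReal.le_tsum x).trans (tsum_econvPow hν n).le

lemma mul_econvPow_le (m n : ℕ) (x y : G) :
    econvPow ν m x * econvPow ν n y ≤ econvPow ν (m + n) (x * y) := by
  rw [econvPow_add]
  refine le_trans ?_ (ENNReal.le_tsum x)
  simp

end ENNReal

section ConvPow

variable {G : Type*} [Group G] {μ : G → ℝ}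

lemma IsProbMeasure.tsum_ofReal {α : Type*} {μ : α → ℝ} (h : IsProbMeasure μ) : ∑' x, ENNReal.ofReal (μ x) = 1 := by
  rw [← ENNReal.ofReal_tsum_of_nonneg h.1 h.2.summable, h.2.tsum_eq, ENNReal.ofReal_one]

lemma convPow_eq_toReal (h : IsProbMeasure μ) (n : ℕ) (x : G) :
    convPow μ n x = (econvPow (fun y => ENNReal.ofReal (μ y)) n x).toReal := by
  induction n generalizing x with
  | zero =>
    simp only [convPow, econvPow]
    split_ifs <;> simp
  | succ n ih =>
    simp only [convPow, econvPow, ih]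
    rw [ENNReal.tsum_toReal_eq]
    · simp [ENNReal.toReal_ofReal (h.1 _)]
    · intro y
      exact ENNReal.mul_ne_top ENNReal.ofReal_ne_top
        (ne_top_of_le_ne_top ENNReal.one_ne_top (econvPow_le_one h.tsum_ofReal _ _))

lemma econvPow_ofReal_ne_top (h : IsProbMeasure μ) (n : ℕ) (x : G) :
    econvPow (fun y => ENNReal.ofReal (μ y)) n x ≠ ⊤ :=
  ne_top_of_le_ne_top ENNReal.one_ne_top (econvPow_le_one h.tsum_ofReal _ _)

lemma convPow_nonneg (h : IsProbMeasure μ) (n : ℕ) (x : G) : 0 ≤ convPow μ n x := by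
  rw [convPow_eq_toReal h]
  exact ENNReal.toReal_nonneg

lemma convPow_le_one (h : IsProbMeasure μ) (n : ℕ) (x : G) : convPow μ n x ≤ 1 := by
  rw [convPow_eq_toReal h]
  exact ENNReal.toReal_mono ENNReal.one_ne_top (econvPow_le_one h.tsum_ofReal n x)

lemma mul_convPow_le (h : IsProbMeasure μ) (m n : ℕ) (x y : G) :
    convPow μ m x * convPow μ n y ≤ convPow μ (m + n) (x * y) := by
  simp only [convPow_eq_toReal h]
  rw [← ENNReal.toReal_mul]
  exact ENNReal.toReal_mono (econvPow_ofReal_ne_top h _ _) (mul_econvPow_le m n x y)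

lemma convPow_two_mul_le (h : IsProbMeasure μ) (hs : IsSymm μ) (n : ℕ) (x : G) :
    convPow μ (n + n) x ≤ convPow μ (n + n) 1 := by
  simp only [convPow_eq_toReal h]
  exact ENNReal.toReal_mono (econvPow_ofReal_ne_top h _ _)
    (econvPow_two_mul_le (fun x => by rw [hs x]) n x)

lemma convPow_two_mul_add_one_le (h : IsProbMeasure μ) (hs : IsSymm μ) (n : ℕ) (x : G) :
    convPow μ (n + n + 1) x ≤ convPow μ (n + n) 1 := by
  simp only [convPow_eq_toReal h]
  exact ENNReal.toReal_mono (econvPow_ofReal_ne_top h _ _)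
    (econvPow_succ_le h.tsum_ofReal _ _ (econvPow_two_mul_le (fun x => by rw [hs x]) n) x)

/-- Return probabilities, hence all transition probabilities, decay geometrically with any rate
above the spectral radius. -/
lemma exists_convPow_le (h : IsProbMeasure μ) (hs : IsSymm μ) {q : ℝ} (hq0 : 0 < q)
    (hq : spectralRadius μ < q) : ∃ C : ℝ, 0 < C ∧ ∀ n x, convPow μ n x ≤ C * q ^ n := by
  have hbdd : IsBoundedUnder (· ≤ ·) atTop
      (fun n : ℕ => (convPow μ n 1) ^ ((n : ℝ)⁻¹)) := by
    refine isBoundedUnder_of ⟨1, fun n => ?_⟩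
    exact Real.rpow_le_one (convPow_nonneg h _ _) (convPow_le_one h _ _) (by positivity)
  have hev := eventually_lt_of_limsup_lt hq hbdd
  obtain ⟨N, hN⟩ := eventually_atTop.mp (hev.and (eventually_ge_atTop 1))
  have hlarge : ∀ n, N ≤ n → convPow μ n 1 ≤ q ^ n := by
    intro n hn
    obtain ⟨h1, h2⟩ := hN n hn
    have hn0 : n ≠ 0 := by omega
    calc convPow μ n 1 = ((convPow μ n 1) ^ ((n : ℝ)⁻¹)) ^ n :=
          (Real.rpow_inv_natCast_pow (convPow_nonneg h _ _) hn0).symm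
      _ ≤ q ^ n := pow_le_pow_left₀ (Real.rpow_nonneg (convPow_nonneg h _ _) _) h1.le n
  set D : ℝ := 1 + ∑ i ∈ Finset.range N, (q ^ i)⁻¹ with hD
  have hsum : 0 ≤ ∑ i ∈ Finset.range N, (q ^ i)⁻¹ :=
    Finset.sum_nonneg fun i _ => by positivity
  have hD1 : 1 ≤ D := by linarith
  have hall : ∀ n, convPow μ n 1 ≤ D * q ^ n := by
    intro n
    have hqn : 0 < q ^ n := by positivity
    rcases le_or_gt N n with hn | hn
    · exact (hlarge n hn).trans (le_mul_of_one_le_left hqn.le hD1)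
    · have h1 : (q ^ n)⁻¹ ≤ D := by
        have := Finset.single_le_sum (f := fun i => (q ^ i)⁻¹)
          (fun i _ => by positivity) (Finset.mem_range.mpr hn)
        linarith
      calc convPow μ n 1 ≤ 1 := convPow_le_one h _ _
        _ = (q ^ n)⁻¹ * q ^ n := (inv_mul_cancel₀ hqn.ne').symm
        _ ≤ D * q ^ n := by gcongr
  have hD0 : 0 < D := by linarith
  refine ⟨D + D / q, by positivity, fun n x => ?_⟩
  rcases Nat.even_or_odd' n with ⟨k, rfl | rfl⟩
  · rw [two_mul]
    refine (convPow_two_mul_le h hs k x).trans ((hall _).trans ?_)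
    have : 0 ≤ D / q * q ^ (k + k) := by positivity
    nlinarith
  · rw [two_mul]
    refine (convPow_two_mul_add_one_le h hs k x).trans ((hall _).trans ?_)
    have h1 : D / q * q ^ (k + k + 1) = D * q ^ (k + k) := by
      rw [pow_succ]; field_simp
    have : 0 ≤ D * q ^ (k + k + 1) := by positivity
    nlinarith

end ConvPow

section WordLength

variable {G : Type*} [Group G] {S : Finset G}

lemma mem_pow_wordLength (hS : Subgroup.closure (S : Set G) = ⊤) (x : G) :
    x ∈ ((S : Set G) ∪ (S : Set G)⁻¹) ^ wordLength S x := by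
  suffices h : ∃ n : ℕ, x ∈ ((S : Set G) ∪ (S : Set G)⁻¹) ^ n from
    Nat.sInf_mem (s := {n : ℕ | x ∈ ((S : Set G) ∪ (S : Set G)⁻¹) ^ n}) h
  have hx : x ∈ Submonoid.closure ((S : Set G) ∪ (S : Set G)⁻¹) := by
    rw [← Subgroup.closure_toSubmonoid, hS]
    trivial
  induction hx using Submonoid.closure_induction with
  | mem x hx => exact ⟨1, by simpa using hx⟩
  | one => exact ⟨0, by simp⟩
  | mul x y _ _ hx hy =>
    obtain ⟨m, hm⟩ := hx
    obtain ⟨n, hn⟩ := hy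
    exact ⟨m + n, by rw [pow_add]; exact Set.mul_mem_mul hm hn⟩

/-- A finite superset of the sphere of radius `n`, of cardinality at most exponential in `n`. -/
lemma exists_finset_sphere (hS : Subgroup.closure (S : Set G) = ⊤) (n : ℕ) :
    ∃ B : Finset G, (∀ x, wordLength S x = n → x ∈ B) ∧ B.card ≤ (S ∪ S⁻¹).card ^ n := by
  refine ⟨(S ∪ S⁻¹) ^ n, fun x hx => ?_, Finset.card_pow_le⟩
  have := mem_pow_wordLength hS x
  rw [hx] at this
  rw [← Finset.mem_coe]
  simpa using this

/-- The Green function decays at most exponentially in the word length. -/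
lemma exists_pow_le_convPow {μ : G → ℝ} (h : IsProbMeasure μ) (hadm : IsAdmissible μ)
    (S : Finset G) {δ : ℝ} (hδ : 0 < δ) :
    ∃ c : ℝ, 0 < c ∧ ∀ (n : ℕ) (x : G), x ∈ ((S : Set G) ∪ (S : Set G)⁻¹) ^ n →
      ∃ k : ℕ, c ^ n ≤ δ ^ k * convPow μ k x := by
  choose k hk using hadm
  have hpos : ∀ x, 0 < δ ^ k x * convPow μ (k x) x := fun x => mul_pos (by positivity) (hk x)
  obtain ⟨c, hc0, hc⟩ : ∃ c : ℝ, 0 < c ∧ ∀ x ∈ S ∪ S⁻¹, c ≤ δ ^ k x * convPow μ (k x) x := by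
    rcases (S ∪ S⁻¹).eq_empty_or_nonempty with he | hne
    · exact ⟨1, one_pos, by simp [he]⟩
    · obtain ⟨a, -, ha⟩ := Finset.exists_min_image (S ∪ S⁻¹)
        (fun x => δ ^ k x * convPow μ (k x) x) hne
      exact ⟨_, hpos a, ha⟩
  refine ⟨c, hc0, fun n => ?_⟩
  induction n with
  | zero =>
    intro x hx
    rw [pow_zero, Set.mem_one] at hx
    exact ⟨0, by simp [convPow, hx]⟩
  | succ n ih =>
    intro x hx
    rw [pow_succ] at hx
    obtain ⟨y, hy, z, hz, rfl⟩ := Set.mem_mul.mp hx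
    obtain ⟨j, hj⟩ := ih y hy
    have hz' : c ≤ δ ^ k z * convPow μ (k z) z := hc z (by
      rw [← Finset.mem_coe]; simpa using hz)
    refine ⟨j + k z, ?_⟩
    calc c ^ (n + 1) = c ^ n * c := pow_succ _ _
      _ ≤ (δ ^ j * convPow μ j y) * (δ ^ k z * convPow μ (k z) z) :=
          mul_le_mul hj hz' hc0.le (le_trans (by positivity) hj)
      _ = δ ^ (j + k z) * (convPow μ j y * convPow μ (k z) z) := by ring
      _ ≤ δ ^ (j + k z) * convPow μ (j + k z) (y * z) := by
          gcongr
          exact mul_convPow_le h _ _ _ _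

end WordLength

/-- A consequence of Jensen's inequality for power series with nonnegative coefficients: if the
mean of the index is at most `M`, the series at `s < r` is at least `(s / r) ^ M` times the series
at `r`. -/
lemma tsum_pow_mul_le_of_mean_le {p : ℕ → ℝ} (hp : ∀ n, 0 ≤ p n) {s r M : ℝ} (hs : 0 < s)
    (hsr : s ≤ r) (h1 : Summable fun n : ℕ => r ^ n * p n)
    (h2 : Summable fun n : ℕ => (n : ℝ) * (r ^ n * p n))
    (hM : ∑' n : ℕ, (n : ℝ) * (r ^ n * p n) ≤ M * ∑' n : ℕ, r ^ n * p n) :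
    ∑' n : ℕ, r ^ n * p n ≤
      Real.exp (M * (Real.log r - Real.log s)) * ∑' n : ℕ, s ^ n * p n := by
  have hr : 0 < r := hs.trans_le hsr
  set u := Real.log r - Real.log s with hu
  have hu0 : 0 ≤ u := sub_nonneg.mpr (Real.log_le_log hs hsr)
  have hsu : ∀ n : ℕ, s ^ n = r ^ n * Real.exp (-(n * u)) := by
    intro n
    have : s = r * Real.exp (-u) := by
      rw [hu, neg_sub, Real.exp_sub, Real.exp_log hs, Real.exp_log hr]
      field_simp
    conv_lhs => rw [this, mul_pow, ← Real.exp_nat_mul]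
    ring_nf
  have h3 : Summable fun n : ℕ => s ^ n * p n :=
    Summable.of_nonneg_of_le (fun n => mul_nonneg (by positivity) (hp n))
      (fun n => mul_le_mul_of_nonneg_right (pow_le_pow_left₀ hs.le hsr n) (hp n)) h1
  have key : ∀ n : ℕ, Real.exp (-(M * u)) *
      ((1 + M * u) * (r ^ n * p n) - u * ((n : ℝ) * (r ^ n * p n))) ≤ s ^ n * p n := by
    intro n
    have ht := Real.add_one_le_exp (M * u - n * u)
    have he : Real.exp (-(n * u)) = Real.exp (-(M * u)) * Real.exp (M * u - n * u) := by
      rw [← Real.exp_add]; ring_nf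
    have hnn : 0 ≤ r ^ n * p n := mul_nonneg (by positivity) (hp n)
    calc _ = (Real.exp (-(M * u)) * (M * u - n * u + 1)) * (r ^ n * p n) := by ring
      _ ≤ (Real.exp (-(M * u)) * Real.exp (M * u - n * u)) * (r ^ n * p n) := by gcongr
      _ = s ^ n * p n := by rw [← he, hsu n]; ring
  have hsum := Summable.tsum_le_tsum key
    (((h1.mul_left (1 + M * u)).sub (h2.mul_left u)).mul_left _) h3
  rw [tsum_mul_left, Summable.tsum_sub (h1.mul_left _) (h2.mul_left u), tsum_mul_left,
    tsum_mul_left] at hsum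
  have h4 : Real.exp (-(M * u)) * ∑' n : ℕ, r ^ n * p n ≤ ∑' n : ℕ, s ^ n * p n := by
    refine le_trans ?_ hsum
    gcongr
    nlinarith
  calc ∑' n : ℕ, r ^ n * p n
      = Real.exp (M * u) * (Real.exp (-(M * u)) * ∑' n : ℕ, r ^ n * p n) := by
        rw [← mul_assoc, ← Real.exp_add]; simp
    _ ≤ _ := by gcongr

/-- Uniform estimates for the Green function for parameters in `[δ, r₁]`. -/
lemma exists_green_bounds {G : Type*} [Group G] {S : Finset G}
    (hS : Subgroup.closure (S : Set G) = ⊤) {μ : G → ℝ}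
    (hprob : IsProbMeasure μ) (hsymm : IsSymm μ) (hadm : IsAdmissible μ) {δ r₁ : ℝ}
    (hδ : 0 < δ) (hδr : δ ≤ r₁) (hr₁ : r₁ < greenRadius μ) :
    ∃ c A K : ℝ, 0 < c ∧ 0 < A ∧ 0 ≤ K ∧
      (∀ r, δ ≤ r → r ≤ r₁ → ∀ x : G,
        c ^ wordLength S x ≤ green μ r x ∧ green μ r x ≤ A) ∧
      ∀ s r, δ ≤ s → s ≤ r → r ≤ r₁ → ∀ x : G, green μ s x ≤ green μ r x ∧
        green μ r x ≤
          Real.exp ((K * wordLength S x + K) * (Real.log r - Real.log s)) * green μ s x := by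
  have hr₁0 : 0 < r₁ := hδ.trans_le hδr
  have hρ : 0 < spectralRadius μ := by
    have : 0 < greenRadius μ := hr₁0.trans hr₁
    exact inv_pos.mp this
  have hρr : spectralRadius μ < r₁⁻¹ := (lt_inv_comm₀ hr₁0 hρ).mp hr₁
  obtain ⟨q, hq1, hq2⟩ := exists_between hρr
  have hq0 : 0 < q := hρ.trans hq1
  obtain ⟨C, hC0, hC⟩ := exists_convPow_le hprob hsymm hq0 hq1
  obtain ⟨c, hc0, hc⟩ := exists_pow_le_convPow hprob hadm S hδ
  have hθ1 : r₁ * q < 1 := by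
    calc r₁ * q < r₁ * r₁⁻¹ := by gcongr
      _ = 1 := mul_inv_cancel₀ hr₁0.ne'
  set θ := r₁ * q with hθ
  have hθ0 : 0 < θ := mul_pos hr₁0 hq0
  set σ := √θ with hσ
  have hσ0 : 0 < σ := Real.sqrt_pos.mpr hθ0
  have hσ1 : σ < 1 := by
    rw [hσ, Real.sqrt_lt' one_pos]; simpa using hθ1
  have hσσ : θ = σ * σ := (Real.mul_self_sqrt hθ0.le).symm
  obtain ⟨k, hk⟩ := exists_pow_lt_of_lt_one hc0 hσ1
  have hterm0 : ∀ r, δ ≤ r → ∀ (x : G) (n : ℕ), 0 ≤ r ^ n * convPow μ n x := fun r hr x n =>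
    mul_nonneg (pow_nonneg (hδ.le.trans hr) n) (convPow_nonneg hprob n x)
  have hterm : ∀ r, δ ≤ r → r ≤ r₁ → ∀ (x : G) (n : ℕ), r ^ n * convPow μ n x ≤ C * θ ^ n := by
    intro r hr hr' x n
    have hr0 : 0 ≤ r := hδ.le.trans hr
    calc r ^ n * convPow μ n x ≤ r₁ ^ n * (C * q ^ n) :=
          mul_le_mul (pow_le_pow_left₀ hr0 hr' n) (hC n x) (convPow_nonneg hprob n x)
            (by positivity)
      _ = C * θ ^ n := by rw [hθ, mul_pow]; ring
  have hgeom : Summable fun n : ℕ => C * θ ^ n :=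
    (summable_geometric_of_lt_one hθ0.le hθ1).mul_left C
  have hsumm : ∀ r, δ ≤ r → r ≤ r₁ → ∀ x : G, Summable fun n : ℕ => r ^ n * convPow μ n x :=
    fun r hr hr' x => Summable.of_nonneg_of_le (hterm0 r hr x) (hterm r hr hr' x) hgeom
  have hlow : ∀ r, δ ≤ r → r ≤ r₁ → ∀ x : G, c ^ wordLength S x ≤ green μ r x := by
    intro r hr hr' x
    obtain ⟨j, hj⟩ := hc _ x (mem_pow_wordLength hS x)
    calc c ^ wordLength S x ≤ δ ^ j * convPow μ j x := hj
      _ ≤ r ^ j * convPow μ j x :=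
          mul_le_mul_of_nonneg_right (pow_le_pow_left₀ hδ.le hr j) (convPow_nonneg hprob j x)
      _ ≤ green μ r x := (hsumm r hr hr' x).le_tsum j fun i _ => hterm0 r hr x i
  have hnσ : Summable fun n : ℕ => (n : ℝ) * σ ^ n := by
    simpa using summable_pow_mul_geometric_of_norm_lt_one 1
      (by rwa [Real.norm_of_nonneg hσ0.le] : ‖σ‖ < 1)
  set B : ℝ := ∑' n : ℕ, (n : ℝ) * σ ^ n with hB
  have hB0 : 0 ≤ B := tsum_nonneg fun n => by positivity
  refine ⟨c, ∑' n : ℕ, C * θ ^ n, k + C * B, hc0, ?_, by positivity, ?_, ?_⟩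
  · exact hgeom.tsum_pos (fun n => by positivity) 0 (by positivity)
  · exact fun r hr hr' x => ⟨hlow r hr hr' x,
      (hsumm r hr hr' x).tsum_le_tsum (hterm r hr hr' x) hgeom⟩
  intro s r hs hsr hr' x
  have hr : δ ≤ r := hs.trans hsr
  have hs0 : 0 < s := hδ.trans_le hs
  refine ⟨(hsumm s hs (hsr.trans hr') x).tsum_le_tsum (fun n => ?_) (hsumm r hr hr' x), ?_⟩
  · exact mul_le_mul_of_nonneg_right (pow_le_pow_left₀ hs0.le hsr n) (convPow_nonneg hprob n x)
  set m := wordLength S x with hm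
  have hbound : ∀ n : ℕ, (n : ℝ) * (r ^ n * convPow μ n x) ≤
      (k * m) * (r ^ n * convPow μ n x) + (C * c ^ m) * ((n : ℝ) * σ ^ n) := by
    intro n
    have h0 := hterm0 r hr x n
    rcases le_or_gt n (k * m) with hn | hn
    · have hn' : (n : ℝ) ≤ k * m := by exact_mod_cast hn
      have : 0 ≤ (C * c ^ m) * ((n : ℝ) * σ ^ n) := by positivity
      nlinarith
    · have h1 : σ ^ n ≤ c ^ m := by
        calc σ ^ n ≤ σ ^ (k * m) := pow_le_pow_of_le_one hσ0.le hσ1.le hn.le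
          _ = (σ ^ k) ^ m := pow_mul _ _ _
          _ ≤ c ^ m := pow_le_pow_left₀ (by positivity) hk.le m
      have h2 : (0 : ℝ) ≤ (k * m) * (r ^ n * convPow μ n x) := by positivity
      calc (n : ℝ) * (r ^ n * convPow μ n x) ≤ n * (C * θ ^ n) :=
            mul_le_mul_of_nonneg_left (hterm r hr hr' x n) (by positivity)
        _ = (C * σ ^ n) * ((n : ℝ) * σ ^ n) := by rw [hσσ, mul_pow]; ring
        _ ≤ (C * c ^ m) * ((n : ℝ) * σ ^ n) := by gcongr
        _ ≤ _ := by linarith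
  have hsR := hsumm r hr hr' x
  have hsummable_bound := (hsR.mul_left ((k : ℝ) * m)).add (hnσ.mul_left (C * c ^ m))
  have hmean_summable : Summable fun n : ℕ => (n : ℝ) * (r ^ n * convPow μ n x) :=
    Summable.of_nonneg_of_le (fun n => mul_nonneg (by positivity) (hterm0 r hr x n)) hbound
      hsummable_bound
  refine tsum_pow_mul_le_of_mean_le (fun n => convPow_nonneg hprob n x) hs0 hsr hsR
    hmean_summable ?_
  have h1 := hmean_summable.tsum_le_tsum hbound hsummable_bound
  rw [(hsR.mul_left ((k : ℝ) * m)).tsum_add (hnσ.mul_left (C * c ^ m)), tsum_mul_left,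
    tsum_mul_left, ← hB] at h1
  have h2 := hlow r hr hr' x
  rw [← hm] at h2
  have hg : green μ r x = ∑' n : ℕ, r ^ n * convPow μ n x := rfl
  rw [← hg] at h1 ⊢
  have hg0 : 0 ≤ green μ r x := le_trans (by positivity) h2
  have h3 : C * c ^ m * B ≤ C * B * green μ r x := by
    calc C * c ^ m * B = C * B * c ^ m := by ring
      _ ≤ _ := by gcongr
  have h4 : 0 ≤ C * B * m * green μ r x := by positivity
  have h5 : 0 ≤ k * green μ r x := by positivity
  nlinarith

/-- Lipschitz estimate for the growth rate as a function of `log r`. -/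
lemma exists_greenGrowthRate_lipschitz {G : Type*} [Group G] {S : Finset G}
    (hS : Subgroup.closure (S : Set G) = ⊤) {μ : G → ℝ}
    (hprob : IsProbMeasure μ) (hsymm : IsSymm μ) (hadm : IsAdmissible μ) {δ r₁ : ℝ}
    (hδ : 0 < δ) (hr₁ : r₁ < greenRadius μ) :
    ∃ c : ℝ, ∀ s r : ℝ, δ ≤ s → s ≤ r → r ≤ r₁ →
      greenGrowthRate S μ s ≤ greenGrowthRate S μ r ∧
      greenGrowthRate S μ r ≤ greenGrowthRate S μ s + c * (Real.log r - Real.log s) := by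
  rcases lt_or_ge r₁ δ with hlt | hδr
  · exact ⟨0, fun s r h1 h2 h3 => absurd (h1.trans (h2.trans h3)) (not_le.mpr hlt)⟩
  obtain ⟨c, A, K, hc0, hA0, hK0, hbd, hlip⟩ :=
    exists_green_bounds hS hprob hsymm hadm hδ hδr hr₁
  choose B hB hBcard using exists_finset_sphere (S := S) hS
  have hsumeq : ∀ r n, greenSphereSum S μ r n =
      ∑ x ∈ (B n).filter (fun x => wordLength S x = n), green μ r x := by
    intro r n
    rw [Finset.sum_filter]
    refine tsum_eq_sum fun x hx => ?_
    rw [if_neg fun h => hx (hB n x h)]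
  set F : ℕ → Finset G := fun n => (B n).filter (fun x => wordLength S x = n) with hF
  have hFlen : ∀ n, ∀ x ∈ F n, wordLength S x = n := fun n x hx => (Finset.mem_filter.mp hx).2
  have hgpos : ∀ r, δ ≤ r → r ≤ r₁ → ∀ x : G, 0 < green μ r x := fun r h1 h2 x =>
    lt_of_lt_of_le (by positivity) (hbd r h1 h2 x).1
  set Q : ℝ := ((S ∪ S⁻¹).card : ℝ) + 1 with hQ
  have hQ1 : 1 ≤ Q := by rw [hQ]; linarith [Nat.cast_nonneg (α := ℝ) (S ∪ S⁻¹).card]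
  have hFcard : ∀ n, ((F n).card : ℝ) ≤ Q ^ n := by
    intro n
    have h1 : (F n).card ≤ (S ∪ S⁻¹).card ^ n := (Finset.card_filter_le _ _).trans (hBcard n)
    calc ((F n).card : ℝ) ≤ ((S ∪ S⁻¹).card : ℝ) ^ n := by exact_mod_cast h1
      _ ≤ Q ^ n := pow_le_pow_left₀ (by positivity) (by rw [hQ]; linarith) n
  have hzero : ∀ n, F n = ∅ → ∀ r, greenSphereSum S μ r n = 0 := by
    intro n hn r
    rw [hsumeq]
    change ∑ x ∈ F n, _ = _
    rw [hn, Finset.sum_empty]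
  have hpos : ∀ n, (F n).Nonempty → ∀ r, δ ≤ r → r ≤ r₁ → 0 < greenSphereSum S μ r n := by
    intro n hn r h1 h2
    rw [hsumeq]
    exact Finset.sum_pos (fun x _ => hgpos r h1 h2 x) hn
  have hupper : ∀ r, δ ≤ r → r ≤ r₁ → ∀ n : ℕ, 1 ≤ n →
      Real.log (greenSphereSum S μ r n) / n ≤ Real.log Q + |Real.log A| := by
    intro r h1 h2 n hn
    have hn' : (1 : ℝ) ≤ n := by exact_mod_cast hn
    have hQl := Real.log_nonneg hQ1
    rw [div_le_iff₀ (by linarith)]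
    rcases (F n).eq_empty_or_nonempty with he | hne
    · rw [hzero n he, Real.log_zero]
      positivity
    · have h3 : greenSphereSum S μ r n ≤ Q ^ n * A := by
        rw [hsumeq]
        calc ∑ x ∈ F n, green μ r x ≤ (F n).card • A :=
              Finset.sum_le_card_nsmul _ _ _ fun x _ => (hbd r h1 h2 x).2
          _ = (F n).card * A := nsmul_eq_mul _ _
          _ ≤ Q ^ n * A := by gcongr; exact hFcard n
      have h4 := Real.log_le_log (hpos n hne r h1 h2) h3
      rw [Real.log_mul (by positivity) (by positivity), Real.log_pow] at h4
      have h5 := le_abs_self (Real.log A)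
      nlinarith [abs_nonneg (Real.log A)]
  have hlower : ∀ r, δ ≤ r → r ≤ r₁ → ∀ n : ℕ, 1 ≤ n →
      -|Real.log c| ≤ Real.log (greenSphereSum S μ r n) / n := by
    intro r h1 h2 n hn
    have hn' : (1 : ℝ) ≤ n := by exact_mod_cast hn
    rw [le_div_iff₀ (by linarith)]
    rcases (F n).eq_empty_or_nonempty with he | hne
    · rw [hzero n he, Real.log_zero]
      have : 0 ≤ |Real.log c| * n := by positivity
      linarith
    · obtain ⟨y, hy⟩ := hne
      have h3 : c ^ n ≤ greenSphereSum S μ r n := by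
        rw [hsumeq]
        calc c ^ n ≤ green μ r y := by
              have := (hbd r h1 h2 y).1
              rwa [hFlen n y hy] at this
          _ ≤ _ := Finset.single_le_sum (f := fun x => green μ r x)
              (fun x _ => (hgpos r h1 h2 x).le) hy
      have h4 := Real.log_le_log (by positivity) h3
      rw [Real.log_pow] at h4
      have h5 := neg_abs_le (Real.log c)
      nlinarith
  have hbA : ∀ r, δ ≤ r → r ≤ r₁ → IsBoundedUnder (· ≤ ·) atTop
      (fun n : ℕ => Real.log (greenSphereSum S μ r n) / n) := fun r h1 h2 =>
    isBoundedUnder_of_eventually_le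
      ((eventually_ge_atTop 1).mono fun n hn => hupper r h1 h2 n hn)
  have hbB : ∀ r, δ ≤ r → r ≤ r₁ → IsBoundedUnder (· ≥ ·) atTop
      (fun n : ℕ => Real.log (greenSphereSum S μ r n) / n) := fun r h1 h2 =>
    isBoundedUnder_of_eventually_ge
      ((eventually_ge_atTop 1).mono fun n hn => hlower r h1 h2 n hn)
  refine ⟨2 * K, fun s r hs hsr hr => ?_⟩
  have hs' : s ≤ r₁ := hsr.trans hr
  have hr' : δ ≤ r := hs.trans hsr
  have hu0 : 0 ≤ Real.log r - Real.log s :=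
    sub_nonneg.mpr (Real.log_le_log (hδ.trans_le hs) hsr)
  set u := Real.log r - Real.log s with hu
  constructor
  · refine limsup_le_limsup (Eventually.of_forall fun n => ?_)
      (hbB s hs hs').isCoboundedUnder_le (hbA r hr' hr)
    dsimp only
    rcases (F n).eq_empty_or_nonempty with he | hne
    · rw [hzero n he, hzero n he]
    · have h1 : greenSphereSum S μ s n ≤ greenSphereSum S μ r n := by
        rw [hsumeq, hsumeq]
        exact Finset.sum_le_sum fun x _ => (hlip s r hs hsr hr x).1
      have h2 := Real.log_le_log (hpos n hne s hs hs') h1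
      gcongr
  · have hev : ∀ᶠ n : ℕ in atTop, Real.log (greenSphereSum S μ r n) / n ≤
        Real.log (greenSphereSum S μ s n) / n + 2 * K * u := by
      filter_upwards [eventually_ge_atTop 1] with n hn
      have hn' : (1 : ℝ) ≤ n := by exact_mod_cast hn
      rcases (F n).eq_empty_or_nonempty with he | hne
      · rw [hzero n he, hzero n he]
        have : 0 ≤ 2 * K * u := by positivity
        linarith
      · have h1 : greenSphereSum S μ r n ≤
            Real.exp ((K * n + K) * u) * greenSphereSum S μ s n := by
          rw [hsumeq, hsumeq, Finset.mul_sum]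
          refine Finset.sum_le_sum fun x hx => ?_
          have := (hlip s r hs hsr hr x).2
          rwa [hFlen n x hx] at this
        have h2 := Real.log_le_log (hpos n hne r hr' hr) h1
        rw [Real.log_mul (Real.exp_pos _).ne' (hpos n hne s hs hs').ne', Real.log_exp] at h2
        have hn0 : (0 : ℝ) < n := by linarith
        rw [div_add' _ _ _ hn0.ne']
        gcongr
        have h3 : 0 ≤ K * u := by positivity
        nlinarith
    have hconst := limsup_add_const atTop
      (fun n : ℕ => Real.log (greenSphereSum S μ s n) / n) (2 * K * u)
      (hbA s hs hs') (hbB s hs hs').isCoboundedUnder_le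
    refine le_trans (limsup_le_limsup hev (hbB r hr' hr).isCoboundedUnder_le ?_) hconst.le
    exact isBoundedUnder_of_eventually_le (a := Real.log Q + |Real.log A| + 2 * K * u)
      ((eventually_ge_atTop 1).mono fun n hn => by
        have := hupper s hs hs' n hn
        linarith)

/-- Let `Γ` be an infinite finitely generated group and let `μ` be a
symmetric admissible probability measure on `Γ`.  Then `r ↦ ω_Γ(r)` is continuous on
`(0, R)`; more precisely, for every `δ > 0` there is a constant `c = c(δ)` such that
for all `δ ≤ s < r ≤ R − δ` one has `0 ≤ ω_Γ(r) − ω_Γ(s) ≤ c (log r − log s)`. -/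
theorem greenGrowthRate_continuous {G : Type*} [Group G] [Infinite G] (S : Finset G)
    (hS : Subgroup.closure (S : Set G) = ⊤) (μ : G → ℝ)
    (hprob : IsProbMeasure μ) (hsymm : IsSymm μ) (hadm : IsAdmissible μ) :
    ContinuousOn (greenGrowthRate S μ) (Set.Ioo 0 (greenRadius μ)) ∧
      ∀ δ : ℝ, 0 < δ → ∃ c : ℝ,
        ∀ s r : ℝ, δ ≤ s → s < r → r ≤ greenRadius μ - δ →
          0 ≤ greenGrowthRate S μ r - greenGrowthRate S μ s ∧
          greenGrowthRate S μ r - greenGrowthRate S μ s ≤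
            c * (Real.log r - Real.log s) := by
  constructor
  · rintro t ⟨ht0, ht1⟩
    refine ContinuousAt.continuousWithinAt ?_
    obtain ⟨a, ha0, hat⟩ := exists_between ht0
    obtain ⟨b, htb, hb1⟩ := exists_between ht1
    obtain ⟨c, hc⟩ := exists_greenGrowthRate_lipschitz hS hprob hsymm hadm ha0 hb1
    have hlog : Tendsto (fun r => |c * (Real.log r - Real.log t)|) (𝓝 t) (𝓝 0) := by
      have h : ContinuousAt (fun r => |c * (Real.log r - Real.log t)|) t :=
        (continuousAt_const.mul ((Real.continuousAt_log ht0.ne').sub continuousAt_const)).abs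
      simpa [ContinuousAt] using h
    refine tendsto_iff_dist_tendsto_zero.mpr
      (squeeze_zero' (Eventually.of_forall fun _ => dist_nonneg) ?_ hlog)
    filter_upwards [Ioo_mem_nhds hat htb] with r hr
    rw [Real.dist_eq]
    rcases le_total r t with h | h
    · obtain ⟨h1, h2⟩ := hc r t hr.1.le h htb.le
      rw [abs_of_nonpos (by linarith)]
      have := neg_abs_le (c * (Real.log r - Real.log t))
      nlinarith
    · obtain ⟨h1, h2⟩ := hc t r hat.le h hr.2.le
      rw [abs_of_nonneg (by linarith)]
      have := le_abs_self (c * (Real.log r - Real.log t))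
      linarith
  · intro δ hδ
    obtain ⟨c, hc⟩ := exists_greenGrowthRate_lipschitz hS hprob hsymm hadm hδ
      (sub_lt_self (greenRadius μ) hδ)
    refine ⟨c, fun s r hs hsr hr => ?_⟩
    obtain ⟨h1, h2⟩ := hc s r hs hsr.le hr
    exact ⟨by linarith, by linarith⟩

end GreenGrowth
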